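/- arXiv:1912.07223 — 2 statements merged into one kernel-verified Lean document; each statement's English description precedes it below -/
import Mathlib

section
/- Let L be a field and τ a field automorphism of L such that every element of L has finite orbit under τ (a periodic difference field). Let K be a subfield of L with τ(K) = K, and let σ = τ|_K; assume every element of K has finite σ-orbit. For n ≥ 1 write K_n for the fixed field of σ^n in K and L_n for the fixed field of τ^n in L (so K_1, L_1 are the fixed fields of σ, τ). Assume (K, σ) is non-degenerate, meaning [K_n : K_1] = n for every n ≥ 1. Then for every n ≥ 1 the natural K_1-algebra homomorphism ψ_n : L_1 ⊗_{K_1} K_n → L induced by the inclusions (sending x ⊗ y to xy) is injective, and its image equals L_n. In particular L_1 ⊗_{K_1} K_n ≅ L_n as K_1-algebras. -/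
set_option synthInstance.maxHeartbeats 1600000
set_option maxHeartbeats 1600000

open scoped TensorProduct

/-- Let `(L, τ)` be a periodic difference field (every element of `L` has finite
orbit under the automorphism `τ`), and `K` a `τ`-invariant subfield, with
`σ = τ|_K`.  For `m ≥ 1` let `L_m` (resp. `K_m`) be the fixed field of `τ^m` in
`L` (resp. of `σ^m` in `K`).  Assume `(K, σ)` is non-degenerate, i.e.
`[K_m : K_1] = m` for all `m ≥ 1`.  Then for every `n ≥ 1` the natural
`K_1`-algebra homomorphism `ψ_n : L_1 ⊗_{K_1} K_n → L`, `x ⊗ y ↦ x·y`,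
is injective and its image is `L_n`.  (Here `E1` and `En` are `L_1` and `K_n`
regarded as intermediate extensions of `K_1` inside `L`, and `ψ_n` is
`Algebra.TensorProduct.productMap E1.val En.val`.) -/
theorem stmt3 (L : Type) [Field L] (τ : L ≃+* L)
    (hper : ∀ x : L, ∃ m : ℕ, 0 < m ∧ (τ ^ m) x = x)
    (K : Subfield L) (hK : K.map (τ : L →+* L) = K)
    (Lfix Kfix : ℕ → Subfield L)
    (hLfix : ∀ m : ℕ,
      Lfix m = ((τ ^ m : L ≃+* L) : L →+* L).eqLocusField (RingHom.id L))
    (hKfix : ∀ m : ℕ, Kfix m = Lfix m ⊓ K)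
    (nondeg : ∀ m : ℕ, 0 < m → ∀ E : IntermediateField (Kfix 1) L,
      (E : Set L) = (Kfix m : Set L) → Module.finrank (Kfix 1) E = m)
    (n : ℕ) (hn : 0 < n)
    (E1 En : IntermediateField (Kfix 1) L)
    (hE1 : (E1 : Set L) = (Lfix 1 : Set L))
    (hEn : (En : Set L) = (Kfix n : Set L)) :
    Function.Injective (Algebra.TensorProduct.productMap E1.val En.val) ∧
      Set.range (Algebra.TensorProduct.productMap E1.val En.val)
        = (Lfix n : Set L) := by
  have memL : ∀ m x, x ∈ Lfix m ↔ (τ ^ m) x = x := by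
    intro m x; rw [hLfix]; rfl
  have memK : ∀ m x, x ∈ Kfix m ↔ (τ ^ m) x = x ∧ x ∈ K := by
    intro m x; rw [hKfix, Subfield.mem_inf, memL]
  have fixpow : ∀ (x : L), τ x = x → ∀ m : ℕ, (τ ^ m) x = x := by
    intro x hx m
    induction m with
    | zero => rfl
    | succ k ih => rw [pow_succ, RingAut.mul_apply, hx, ih]
  have memEn : ∀ x, x ∈ En ↔ x ∈ Kfix n := fun x => Set.ext_iff.mp hEn x
  have memE1 : ∀ x, x ∈ E1 ↔ τ x = x := by
    intro x
    have := Set.ext_iff.mp hE1 x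
    exact this.trans ((memL 1 x).trans (by rw [pow_one]))
  have K1fix : ∀ x : Kfix 1, ∀ m : ℕ, (τ ^ m) (x : L) = x := by
    intro x m
    have := ((memK 1 x).1 x.2).1
    rw [pow_one] at this
    exact fixpow _ this m
  have K1le : ∀ m, Kfix 1 ≤ Kfix m := by
    intro m x hx
    exact (memK m x).2 ⟨K1fix ⟨x, hx⟩ m, ((memK 1 x).1 hx).2⟩
  have hfr := nondeg n hn En hEn
  -- the restrictions of the powers of `τ` to `K_n`
  let f : Fin n → (En →* L) := fun i =>
    ((((τ ^ (i : ℕ) : L ≃+* L) : L →+* L).comp (algebraMap En L) : En →+* L) : En →* L)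
  have hf : ∀ i x, f i x = (τ ^ (i : ℕ)) (x : L) := fun i x => rfl
  have key : ∀ i j : Fin n, i < j → f i ≠ f j := by
    intro i j hij h
    obtain ⟨d, hd⟩ : ∃ d, (j : ℕ) = i + d := ⟨j - i, by omega⟩
    have hd0 : 0 < d := by omega
    have hdn : d < n := by omega
    let Ed : IntermediateField (Kfix 1) L :=
      (Kfix d).toIntermediateField (fun x => K1le d x.2)
    have h1 := nondeg d hd0 Ed rfl
    have hle : En ≤ Ed := by
      intro x hx
      have h2 := DFunLike.congr_fun h ⟨x, hx⟩
      rw [hf, hf, hd, pow_add, RingAut.mul_apply] at h2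
      have h3 := (τ ^ (i : ℕ)).injective h2
      exact (memK d x).2 ⟨h3.symm, ((memK n x).1 ((memEn x).1 hx)).2⟩
    haveI : FiniteDimensional (Kfix 1) Ed := FiniteDimensional.of_finrank_pos (by omega)
    have h4 : Module.finrank (Kfix 1) En ≤ Module.finrank (Kfix 1) Ed :=
      LinearMap.finrank_le_finrank_of_injective
        (f := (IntermediateField.inclusion hle).toLinearMap)
        (IntermediateField.inclusion_injective hle)
    omega
  have finj : Function.Injective f := by
    intro i j h
    rcases lt_trichotomy i j with h1 | h1 | h1
    · exact absurd h (key i j h1)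
    · exact h1
    · exact absurd h.symm (key j i h1)
  have hind := (linearIndependent_monoidHom En L).comp f finj
  haveI : FiniteDimensional (Kfix 1) En := FiniteDimensional.of_finrank_pos (by omega)
  let b : Module.Basis (Fin n) (Kfix 1) En := Module.finBasisOfFinrankEq (Kfix 1) En hfr
  let M : Matrix (Fin n) (Fin n) L := Matrix.of fun i j => (τ ^ (i : ℕ)) (b j : L)
  have hMu : IsUnit M := by
    rw [← Matrix.vecMul_injective_iff_isUnit]
    rw [← Matrix.coe_vecMulLinear, injective_iff_map_eq_zero]
    intro c hc
    have hc' : ∀ j, ∑ i, c i * (τ ^ (i : ℕ)) (b j : L) = 0 := fun j => congrFun hc j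
    refine funext fun i => ?_
    refine Fintype.linearIndependent_iff.1 hind c ?_ i
    funext x
    have hx := b.sum_repr x
    have hx' : (x : L) = ∑ j, (b.repr x j : L) * (b j : L) := by
      conv_lhs => rw [← hx]
      push_cast
      rfl
    simp only [Finset.sum_apply, Pi.smul_apply, Function.comp, smul_eq_mul, Pi.zero_apply]
    simp only [hf]
    rw [hx']
    simp only [map_sum, map_mul, K1fix, Finset.mul_sum]
    rw [Finset.sum_comm]
    refine Finset.sum_eq_zero fun j _ => ?_
    calc _ = (b.repr x j : L) * ∑ i, c i * (τ ^ (i : ℕ)) (b j : L) := by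
          rw [Finset.mul_sum]; exact Finset.sum_congr rfl fun i _ => by ring
      _ = 0 := by rw [hc', mul_zero]
  have hMinj : Function.Injective M.mulVec := Matrix.mulVec_injective_iff_isUnit.2 hMu
  have hMsurj : Function.Surjective M.mulVec := Matrix.mulVec_surjective_iff_isUnit.2 hMu
  have hMv : ∀ v i, M.mulVec v i = ∑ j, (τ ^ (i : ℕ)) (b j : L) * v j := fun v i => rfl
  have bn : ∀ j, (τ ^ n) (b j : L) = b j := fun j =>
    ((memK n _).1 ((memEn _).1 (b j).2)).1
  constructor
  · rw [injective_iff_map_eq_zero]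
    intro t ht
    obtain ⟨x, rfl⟩ : ∃ x : Fin n → E1, t = ∑ j, x j ⊗ₜ[Kfix 1] b j := by
      let B := b.baseChange E1
      refine ⟨fun j => B.repr t j, ?_⟩
      conv_lhs => rw [← B.sum_repr t]
      refine Finset.sum_congr rfl fun j _ => ?_
      simp [B, TensorProduct.smul_tmul']
    have h0 : ∑ j, (x j : L) * (b j : L) = 0 := by
      simpa [map_sum] using ht
    have hx : (fun j => (x j : L)) = 0 := by
      apply hMinj
      rw [Matrix.mulVec_zero]
      funext i
      rw [hMv]
      have h1 := congrArg (τ ^ (i : ℕ)) h0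
      rw [map_sum, map_zero] at h1
      rw [Pi.zero_apply, ← h1]
      refine Finset.sum_congr rfl fun j _ => ?_
      rw [map_mul, fixpow (x j) ((memE1 _).1 (x j).2), mul_comm]
    refine Finset.sum_eq_zero fun j _ => ?_
    have : x j = 0 := Subtype.ext (congrFun hx j)
    rw [this, TensorProduct.zero_tmul]
  · apply Set.Subset.antisymm
    · rintro _ ⟨t, rfl⟩
      rw [SetLike.mem_coe]
      induction t using TensorProduct.induction_on with
      | zero => rw [map_zero]; exact zero_mem _
      | add a c ha hc => rw [map_add]; exact add_mem ha hc
      | tmul x y =>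
        rw [Algebra.TensorProduct.productMap_apply_tmul]
        refine mul_mem ((memL n _).2 (fixpow _ ((memE1 _).1 x.2) n)) ?_
        exact (memL n _).2 ((memK n _).1 ((memEn _).1 y.2)).1
    · intro y hy
      have hy' : (τ ^ n) y = y := (memL n y).1 hy
      obtain ⟨x, hx⟩ := hMsurj (fun i => (τ ^ (i : ℕ)) y)
      have hx' : ∀ i : ℕ, i < n → ∑ j, (τ ^ i) (b j : L) * x j = (τ ^ i) y :=
        fun i hi => congrFun hx ⟨i, hi⟩
      have hstep : ∀ i : ℕ, i < n →
          ∑ j, (τ ^ (i + 1)) (b j : L) * τ (x j) = (τ ^ (i + 1)) y := by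
        intro i hi
        have := congrArg τ (hx' i hi)
        rw [map_sum] at this
        simpa only [map_mul, pow_succ', RingAut.mul_apply] using this
      have hτ : (fun j => τ (x j)) = x := by
        apply hMinj
        rw [hx]
        funext i
        rw [hMv]
        obtain ⟨i, hi⟩ := i
        cases i with
        | zero =>
          have h := hstep (n - 1) (by omega)
          rw [Nat.sub_add_cancel hn] at h
          simp only [bn, hy'] at h
          simpa using h
        | succ k => exact hstep k (by omega)
      refine ⟨∑ j, (⟨x j, (memE1 _).2 (congrFun hτ j)⟩ : E1) ⊗ₜ[Kfix 1] b j, ?_⟩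
      rw [map_sum]
      have h := hx' 0 hn
      simp only [pow_zero, RingAut.one_apply] at h
      rw [← h]
      refine Finset.sum_congr rfl fun j _ => ?_
      rw [Algebra.TensorProduct.productMap_apply_tmul, mul_comm]
      rfl
end

section
/- Let L⁻ ⊆ L⁺ be first-order languages (more generally, fix an expansion morphism of languages L⁻ → L⁺). Let C be a class of L⁻-structures and let T⁻ be the common L⁻-theory of C, i.e. T⁻ = {σ : σ is an L⁻-sentence satisfied by every member of C}. Let T⁺ be an L⁺-theory containing T⁻ (viewed as L⁺-sentences). Suppose: (i) every model of T⁻ has at most one expansion to a model of T⁺, meaning that any two L⁺-structures on the same underlying set whose L⁻-reducts coincide and model T⁻, and which both satisfy T⁺, are equal as L⁺-structures; and (ii) every member of C has at least one expansion to a model of T⁺. Then every model of T⁻ has exactly one expansion to a model of T⁺. -/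
open FirstOrder Language

namespace BethAux
open Structure

/-- `f` is elementary for all `L`-formulas with variables in a small type. -/
def Elem (L : Language) {M N : Type} [L.Structure M] [L.Structure N] (f : M → N) : Prop :=
  ∀ (α : Type) (ψ : L.Formula α) (v : α → M), ψ.Realize (f ∘ v) ↔ ψ.Realize v

/-- `f` is elementary for all translated `Lm`-formulas. -/
def ElemR {Lm Lp : Language} (φ : Lm →ᴸ Lp) {M N : Type} [Lp.Structure M] [Lp.Structure N]
    (f : M → N) : Prop :=
  ∀ (α : Type) (ψ : Lm.Formula α) (v : α → M),
    (φ.onFormula ψ).Realize (f ∘ v) ↔ (φ.onFormula ψ).Realize v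

section basic
variable {L : Language} {M N : Type} [L.Structure M] [L.Structure N] {f : M → N}

theorem Elem.inj (h : Elem L f) : Function.Injective f := by
  intro x y hxy
  have := h Bool (Term.equal (Term.var true) (Term.var false)) (fun b => if b then x else y)
  simpa [Formula.realize_equal, hxy] using this

theorem Elem.funMap (h : Elem L f) {n : ℕ} (g : L.Functions n) (x : Fin n → M) :
    f (funMap g x) = funMap g (f ∘ x) := by
  have := h (Option (Fin n)) (Term.equal (Term.var none) (Term.func g (fun i => Term.var (some i))))
    (fun o => o.elim (Structure.funMap g x) x)
  simpa [Formula.realize_equal, Function.comp_def] using this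

theorem Elem.relMap (h : Elem L f) {n : ℕ} (r : L.Relations n) (x : Fin n → M) :
    RelMap r (f ∘ x) ↔ RelMap r x := by
  have := h (Fin n) (Relations.formula r (fun i => Term.var i)) x
  simpa [Formula.realize_rel, Function.comp_def] using this

end basic

/-- An ultrafilter containing a multiplicative family of nonempty sets. -/
theorem exists_ultra {I : Type} (S : Set (Set I)) (hne : S.Nonempty)
    (h1 : ∀ s ∈ S, s.Nonempty) (h2 : ∀ s ∈ S, ∀ t ∈ S, s ∩ t ∈ S) :
    ∃ U : Ultrafilter I, ∀ s ∈ S, s ∈ U := by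
  obtain ⟨U, hU⟩ := Ultrafilter.exists_ultrafilter_of_finite_inter_nonempty S (by
    intro T
    classical
    have key : (T : Set (Set I)) ⊆ S → ∃ s ∈ S, s ⊆ ⋂₀ (T : Set (Set I)) := by
      induction T using Finset.induction_on with
      | empty =>
        intro _
        obtain ⟨s, hs⟩ := hne
        exact ⟨s, hs, by simp⟩
      | insert a T _ ih =>
        intro hT
        rw [Finset.coe_insert, Set.insert_subset_iff] at hT
        obtain ⟨s, hs, hs'⟩ := ih hT.2
        refine ⟨a ∩ s, h2 _ hT.1 _ hs, ?_⟩
        rw [Finset.coe_insert, Set.sInter_insert]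
        exact Set.inter_subset_inter_right _ hs'
    intro hT
    obtain ⟨s, hs, hs'⟩ := key hT
    exact (h1 s hs).mono hs')
  exact ⟨U, fun s hs => hU hs⟩

/-- Existential closure over all variables outside the image of `a`. -/
theorem exists_closure {L : Language} {M α : Type} [L.Structure M] (a : α → M)
    (θ : L.Formula M) (hθ : θ.Realize id) :
    ∃ χ : L.Formula α, χ.Realize a ∧
      ∀ (N : Type) [L.Structure N] [Nonempty N] (b : α → N),
        (∀ x y, a x = a y → b x = b y) → χ.Realize b →
          ∃ v : M → N, v ∘ a = b ∧ θ.Realize v := by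
  classical
  let ρ : θ.freeVarFinset → α ⊕ θ.freeVarFinset := fun m =>
    if h : ∃ x, a x = m then Sum.inl h.choose else Sum.inr m
  refine ⟨Formula.iExs θ.freeVarFinset (θ.restrictFreeVar ρ), ?_, ?_⟩
  · rw [Formula.realize_iExs]
    refine ⟨fun m => m, ?_⟩
    refine (BoundedFormula.realize_restrictFreeVar (v' := id) ?_).2 hθ
    intro m
    by_cases h : ∃ x, a x = m
    · simp only [ρ, dif_pos h]
      exact h.choose_spec
    · simp only [ρ, dif_neg h]
      rfl
  · intro N _ _ b hab h
    rw [Formula.realize_iExs] at h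
    obtain ⟨w, hw⟩ := h
    let v : M → N := fun m => if h : ∃ x, a x = m then b h.choose else
      if h : m ∈ θ.freeVarFinset then w ⟨m, h⟩ else Classical.arbitrary N
    refine ⟨v, ?_, ?_⟩
    · funext x
      have h : ∃ y, a y = a x := ⟨x, rfl⟩
      simp only [v, Function.comp, dif_pos h]
      exact hab _ _ h.choose_spec
    · refine (BoundedFormula.realize_restrictFreeVar (v' := v) ?_).1 hw
      intro m
      by_cases h : ∃ x, a x = m
      · simp only [ρ, v, dif_pos h, Sum.elim_inl]
      · simp only [ρ, v, dif_neg h, Sum.elim_inr, m.2, dif_pos, Subtype.coe_eta]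

/-- Transfer of equalities along types. -/
theorem eq_of_type {L : Language} {M N α : Type} [L.Structure M] [L.Structure N]
    {a : α → M} {b : α → N} (h : ∀ ψ : L.Formula α, ψ.Realize a → ψ.Realize b)
    (x y : α) (hxy : a x = a y) : b x = b y := by
  have := h (Term.equal (Term.var x) (Term.var y))
  simpa [Formula.realize_equal, hxy] using this

/-- Class map into an ultraproduct. -/
abbrev cls {I : Type} (U : Ultrafilter I) (X : I → Type) (x : ∀ i, X i) :
    (U : Filter I).Product X :=
  @Quotient.mk' _ ((U : Filter I).productSetoid X) x

theorem los {L : Language} {I : Type} (U : Ultrafilter I) (X : I → Type)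
    [∀ i, L.Structure (X i)] [∀ i, Nonempty (X i)] {β : Type} (ψ : L.Formula β)
    (x : β → ∀ i, X i) :
    ψ.Realize (fun b => cls U X (x b)) ↔ ∀ᶠ i in (U : Filter I), ψ.Realize (fun b => x b i) :=
  Ultraproduct.realize_formula_cast ψ x

theorem realize_relabelR {Lm Lp : Language} (φ : Lm →ᴸ Lp) {M α β : Type} [Lp.Structure M]
    (θ : Lm.Formula α) (g : α → β) (v : β → M) :
    (φ.onFormula (θ.relabel g)).Realize v ↔ (φ.onFormula θ).Realize (v ∘ g) := by
  let _ := φ.reduct M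
  rw [LHom.realize_onFormula, LHom.realize_onFormula, Formula.realize_relabel]

/-- Frayne's lemma. -/
theorem frayne {Lm Lp : Language} (φ : Lm →ᴸ Lp) {I : Type} (X : I → Type)
    [∀ i, Lp.Structure (X i)] [∀ i, Nonempty (X i)] {M : Type} [Lm.Structure M]
    (w : ∀ i, M → X i)
    (h : ∀ θ : Lm.Formula M, θ.Realize id → ∃ i, (φ.onFormula θ).Realize (w i)) :
    ∃ U : Ultrafilter I, ∀ (α : Type) (θ : Lm.Formula α) (v : α → M),
      (φ.onFormula θ).Realize (fun x => cls U X (fun i => w i (v x))) ↔ θ.Realize v := by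
  obtain ⟨U, hU⟩ := exists_ultra
    {s | ∃ θ : Lm.Formula M, θ.Realize id ∧ s = {i | (φ.onFormula θ).Realize (w i)}}
    ⟨_, ⊤, by simp, rfl⟩
    (by
      rintro _ ⟨θ, hθ, rfl⟩
      exact h θ hθ)
    (by
      rintro _ ⟨θ, hθ, rfl⟩ _ ⟨θ', hθ', rfl⟩
      refine ⟨θ ⊓ θ', by simp [hθ, hθ'], ?_⟩
      ext i
      let _ := φ.reduct (X i)
      simp [LHom.realize_onFormula, Formula.realize_inf])
  have key : ∀ θ : Lm.Formula M, θ.Realize id →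
      ∀ᶠ i in (U : Filter I), (φ.onFormula θ).Realize (w i) :=
    fun θ hθ => hU _ ⟨θ, hθ, rfl⟩
  refine ⟨U, fun α θ v => ?_⟩
  rw [los]
  have e : ∀ i, ((φ.onFormula θ).Realize fun b => w i (v b)) ↔
      (φ.onFormula (θ.relabel v)).Realize (w i) := fun i => (realize_relabelR φ θ v (w i)).symm
  simp only [e]
  constructor
  · intro hr
    by_contra hn
    have h2 := key (∼(θ.relabel v)) (by
      rw [Formula.realize_not, Formula.realize_relabel]; exact hn)
    obtain ⟨i, h3, h4⟩ := (hr.and h2).exists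
    let _ := φ.reduct (X i)
    rw [LHom.realize_onFormula] at h3 h4
    exact h4 h3
  · intro hr
    exact key _ (by rw [Formula.realize_relabel]; exact hr)

/-- One step of the alternating chain. -/
theorem step {Lm Lp : Language} (φ : Lm →ᴸ Lp) {α M N : Type} [Lp.Structure M] [Lp.Structure N]
    [Nonempty N] (a : α → M) (b : α → N)
    (h : ∀ ψ : Lm.Formula α, (φ.onFormula ψ).Realize a → (φ.onFormula ψ).Realize b) :
    ∃ (N' : Type) (_ : Lp.Structure N') (_ : Nonempty N') (g : M → N') (d : N → N'),
      ElemR φ g ∧ Elem Lp d ∧ g ∘ a = d ∘ b := by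
  let _ := φ.reduct M
  let _ := φ.reduct N
  simp only [LHom.realize_onFormula] at h
  let I : Type := {v : M → N // v ∘ a = b}
  obtain ⟨U, hU⟩ := frayne φ (I := I) (fun _ => N) (fun v => v.1) (by
    intro θ hθ
    obtain ⟨χ, h1, h2⟩ := exists_closure a θ hθ
    obtain ⟨v, hv, hv'⟩ := h2 N b (eq_of_type h) (h χ h1)
    exact ⟨⟨v, hv⟩, by rwa [LHom.realize_onFormula]⟩)
  refine ⟨_, inferInstance, Ultraproduct.Product.instNonempty,
    fun m => cls U (fun _ => N) (fun v => v.1 m),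
    fun n => cls U (fun _ => N) (fun _ => n), ?_, ?_, ?_⟩
  · intro β ψ v
    exact (hU β ψ v).trans (LHom.realize_onFormula φ ψ).symm
  · intro β ψ v
    refine (los U (fun _ => N) ψ (fun x _ => v x)).trans ?_
    simp
  · funext x
    exact congrArg (cls U (fun _ => N)) (funext fun v => congrFun v.2 x)

/-- The union of an elementary chain, as a structure on a given set-theoretic limit. -/
theorem union_structure {L : Language} (E : ℕ → Type) [∀ k, L.Structure (E k)]
    (e : ∀ k, E k → E (k + 1)) (he : ∀ k, Elem L (e k)) (D : Type) (π : ∀ k, E k → D)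
    (hπ : ∀ k, Function.Injective (π k)) (hc : ∀ k x, π (k + 1) (e k x) = π k x)
    (hs : ∀ d, ∃ k x, π k x = d) :
    ∃ _ : L.Structure D, ∀ k, Elem L (π k) := by
  classical
  have ht : ∀ k m, k ≤ m → ∃ t : E k → E m, Elem L t ∧ ∀ x, π m (t x) = π k x := by
    intro k m hkm
    induction m, hkm using Nat.le_induction with
    | base => exact ⟨id, fun _ _ _ => Iff.rfl, fun _ => rfl⟩
    | succ m _ ih =>
      obtain ⟨t, h1, h2⟩ := ih
      exact ⟨e m ∘ t, fun α ψ v => (he m α ψ (t ∘ v)).trans (h1 α ψ v),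
        fun x => (hc m (t x)).trans (h2 x)⟩
  have htup : ∀ (n : ℕ) (x : Fin n → D), ∃ k, ∃ y : Fin n → E k, π k ∘ y = x := by
    intro n x
    choose k y hy using fun i => hs (x i)
    have hk : ∀ i, k i ≤ Finset.univ.sup k := fun i => Finset.le_sup (Finset.mem_univ i)
    choose t _ ht2 using fun i => ht (k i) _ (hk i)
    exact ⟨Finset.univ.sup k, fun i => t i (y i), funext fun i => (ht2 i (y i)).trans (hy i)⟩
  have hjoin : ∀ {n : ℕ} {k k' : ℕ} (y : Fin n → E k) (y' : Fin n → E k'),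
      π k ∘ y = π k' ∘ y' → ∃ (m : ℕ) (t : E k → E m) (t' : E k' → E m),
        Elem L t ∧ Elem L t' ∧ (∀ x, π m (t x) = π k x) ∧ (∀ x, π m (t' x) = π k' x) ∧
        t ∘ y = t' ∘ y' := by
    intro n k k' y y' hyy
    obtain ⟨t, h1, h2⟩ := ht k (max k k') (le_max_left _ _)
    obtain ⟨t', h1', h2'⟩ := ht k' (max k k') (le_max_right _ _)
    refine ⟨_, t, t', h1, h1', h2, h2', funext fun i => hπ _ ?_⟩
    simp only [Function.comp, h2, h2']
    exact congrFun hyy i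
  choose K Y hY using htup
  let S : L.Structure D :=
    { funMap := fun {n} f x => π (K n x) (funMap f (Y n x))
      RelMap := fun {n} r x => RelMap r (Y n x) }
  have hfun : ∀ {n : ℕ} (f : L.Functions n) (k : ℕ) (y : Fin n → E k),
      funMap f (π k ∘ y) = π k (funMap f y) := by
    intro n f k y
    obtain ⟨m, t, t', h1, h1', h2, h2', h3⟩ := hjoin _ _ (hY n (π k ∘ y))
    change π _ (funMap f (Y n (π k ∘ y))) = _
    rw [← h2, ← h2', h1.funMap, h1'.funMap, h3]
  have hrel : ∀ {n : ℕ} (r : L.Relations n) (k : ℕ) (y : Fin n → E k),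
      RelMap r (π k ∘ y) ↔ RelMap r y := by
    intro n r k y
    obtain ⟨m, t, t', h1, h1', h2, h2', h3⟩ := hjoin _ _ (hY n (π k ∘ y))
    change RelMap r (Y n (π k ∘ y)) ↔ _
    rw [← h1.relMap, ← h1'.relMap, h3]
  have hterm : ∀ (k : ℕ) {β : Type} (t : L.Term β) (v : β → E k),
      t.realize (π k ∘ v) = π k (t.realize v) := by
    intro k β t v
    induction t with
    | var => rfl
    | func f ts ih =>
      simp only [Term.realize, ih]
      exact hfun f k _
  have hbd : ∀ {α : Type} {n : ℕ} (ψ : L.BoundedFormula α n) (k : ℕ) (v : α → E k)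
      (xs : Fin n → E k), ψ.Realize (π k ∘ v) (π k ∘ xs) ↔ ψ.Realize v xs := by
    intro α n ψ
    induction ψ with
    | falsum => intro k v xs; rfl
    | equal t₁ t₂ =>
      intro k v xs
      simp only [BoundedFormula.Realize, ← Sum.comp_elim, hterm]
      exact (hπ k).eq_iff
    | rel R ts =>
      intro k v xs
      simp only [BoundedFormula.Realize, ← Sum.comp_elim, hterm]
      exact hrel R k _
    | imp _ _ ih1 ih2 =>
      intro k v xs
      simp only [BoundedFormula.Realize, ih1, ih2]
    | @all n ψ ih =>
      intro k v xs
      simp only [BoundedFormula.Realize]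
      constructor
      · intro h x
        rw [← ih, Fin.comp_snoc]
        exact h (π k x)
      · intro h d
        obtain ⟨k', x, rfl⟩ := hs d
        obtain ⟨t, h1, h2⟩ := ht k (max k k') (le_max_left _ _)
        obtain ⟨t', h1', h2'⟩ := ht k' (max k k') (le_max_right _ _)
        have h4 : ψ.all.Realize (t ∘ v) (t ∘ xs) := by
          have := h1 _ ψ.all.toFormula (Sum.elim v xs)
          simp only [BoundedFormula.realize_toFormula] at this
          exact this.2 h
        have h5 := (ih (max k k') (t ∘ v) (Fin.snoc (t ∘ xs) (t' x))).2 (h4 (t' x))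
        rw [Fin.comp_snoc, h2'] at h5
        have e1 : π (max k k') ∘ t ∘ v = π k ∘ v := funext fun i => h2 _
        have e2 : π (max k k') ∘ t ∘ xs = π k ∘ xs := funext fun i => h2 _
        rw [e1, e2] at h5
        exact h5
  refine ⟨S, fun k α ψ v => ?_⟩
  have := hbd ψ k v default
  rw [Formula.Realize, Formula.Realize, ← this]
  exact iff_of_eq (congrArg _ (Subsingleton.elim _ _))

/-- Set-theoretic direct limit of a sequence of injections. -/
theorem exists_lim (E : ℕ → Type) (e : ∀ k, E k → E (k + 1))
    (he : ∀ k, Function.Injective (e k)) :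
    ∃ (D : Type) (π : ∀ k, E k → D), (∀ k, Function.Injective (π k)) ∧
      (∀ k x, π (k + 1) (e k x) = π k x) ∧ ∀ d, ∃ k x, π k x = d := by
  let _ : ∀ k, Language.empty.Structure (E k) := fun k =>
    { funMap := fun f => isEmptyElim f, RelMap := fun r => isEmptyElim r }
  let e' : ∀ k, E k ↪[Language.empty] E (k + 1) := fun k =>
    { toFun := e k
      inj' := he k
      map_fun' := fun f => isEmptyElim f
      map_rel' := fun f => isEmptyElim f }
  refine ⟨Language.DirectLimit E (DirectedSystem.natLERec e'),
    fun k => Language.DirectLimit.of Language.empty ℕ E (DirectedSystem.natLERec e') k,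
    fun k => Embedding.injective _, fun k x => ?_, fun d => Language.DirectLimit.exists_of d⟩
  have := Language.DirectLimit.of_f (L := Language.empty) (ι := ℕ) (G := E)
    (f := DirectedSystem.natLERec e') (i := k) (j := k + 1) (hij := Nat.le_succ k) (x := x)
  refine Eq.trans ?_ this
  refine congrArg _ ?_
  simp [DirectedSystem.coe_natLERec, Nat.leRecOn_succ', e']
  rfl

/-- A stage of the alternating chain. -/
structure Stage {Lm Lp : Language} (φ : Lm →ᴸ Lp) where
  /-- first structure -/
  A : Type
  /-- second structure -/
  B : Type
  [sA : Lp.Structure A]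
  [sB : Lp.Structure B]
  [nA : Nonempty A]
  [nB : Nonempty B]
  /-- the small-language elementary map -/
  f : A → B
  hf : ElemR φ f

attribute [instance] Stage.sA Stage.sB Stage.nA Stage.nB

theorem Stage.next {Lm Lp : Language} {φ : Lm →ᴸ Lp} (s : Stage φ) :
    ∃ (t : Stage φ) (g : s.B → t.A), Elem Lp (g ∘ s.f) ∧ Elem Lp (t.f ∘ g) := by
  obtain ⟨A', sA', nA', g, d, hg, hd, h⟩ := step φ s.f (id : s.A → s.A)
    (fun ψ => (s.hf _ ψ id).1)
  obtain ⟨B', sB', nB', f', d', hf', hd', h'⟩ := step φ g (id : s.B → s.B)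
    (fun ψ => (hg _ ψ id).1)
  refine ⟨⟨A', B', f', hf'⟩, g, ?_, ?_⟩
  · rw [h]; exact hd
  · change Elem Lp (f' ∘ g)
    rw [h']; exact hd'

theorem amalg_aux {Lm Lp : Language} {φ : Lm →ᴸ Lp} (T : ℕ → Stage φ)
    (g : ∀ k, (T k).B → (T (k + 1)).A) (hA : ∀ k, Elem Lp (g k ∘ (T k).f))
    (hB : ∀ k, Elem Lp ((T (k + 1)).f ∘ g k)) :
    ∃ (D : Type) (S₁ S₂ : Lp.Structure D) (p : (T 0).A → D) (q : (T 0).B → D),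
      @LHom.reduct Lm Lp φ D S₁ = @LHom.reduct Lm Lp φ D S₂ ∧
      @Elem Lp (T 0).A D _ S₁ p ∧ @Elem Lp (T 0).B D _ S₂ q ∧ q ∘ (T 0).f = p := by
  let eA : ∀ k, (T k).A → (T (k + 1)).A := fun k x => g k ((T k).f x)
  let eB : ∀ k, (T k).B → (T (k + 1)).B := fun k x => (T (k + 1)).f (g k x)
  have heA : ∀ k : ℕ, Elem Lp (eA k) := fun k => hA k
  have heB : ∀ k : ℕ, Elem Lp (eB k) := fun k => hB k
  obtain ⟨D, π, h1, h2, h3⟩ := exists_lim (fun k => (T k).A) eA (fun k => (heA k).inj)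
  let ρ : ∀ k, (T k).B → D := fun k => π (k + 1) ∘ g k
  have hρ : ∀ k x, ρ k ((T k).f x) = π k x := fun k x => h2 k x
  obtain ⟨S₁, hS₁⟩ := union_structure (L := Lp) (fun k => (T k).A) eA heA D π h1 h2 h3
  obtain ⟨S₂, hS₂⟩ := union_structure (L := Lp) (fun k => (T k).B) eB heB D ρ
    (fun k => (h1 (k + 1)).comp (Function.Injective.of_comp (heB k).inj))
    (fun k x => h2 (k + 1) (g k x))
    (fun d => by
      obtain ⟨k, x, rfl⟩ := h3 d
      exact ⟨k, (T k).f x, hρ k x⟩)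
  refine ⟨D, S₁, S₂, π 0, ρ 0, ?_, hS₁ 0, hS₂ 0, funext (hρ 0)⟩
  have htup : ∀ (n : ℕ) (x : Fin n → D), ∃ k, ∃ y : Fin n → (T k).A, π k ∘ y = x := by
    have ht : ∀ k m, k ≤ m → ∃ t : (T k).A → (T m).A, ∀ x, π m (t x) = π k x := by
      intro k m hkm
      induction m, hkm using Nat.le_induction with
      | base => exact ⟨id, fun _ => rfl⟩
      | succ m _ ih =>
        obtain ⟨t, h⟩ := ih
        exact ⟨eA m ∘ t, fun x => (h2 m (t x)).trans (h x)⟩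
    intro n x
    choose k y hy using fun i => h3 (x i)
    have hk : ∀ i, k i ≤ Finset.univ.sup k := fun i => Finset.le_sup (Finset.mem_univ i)
    choose t ht2 using fun i => ht (k i) _ (hk i)
    exact ⟨Finset.univ.sup k, fun i => t i (y i), funext fun i => (ht2 i (y i)).trans (hy i)⟩
  have hm : ∀ k, @Elem Lm (T k).A (T k).B (φ.reduct _) (φ.reduct _) (T k).f := by
    intro k α ψ v
    have := (T k).hf α ψ v
    let _ := φ.reduct (T k).A
    let _ := φ.reduct (T k).B
    rwa [LHom.realize_onFormula, LHom.realize_onFormula] at this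
  have e : ∀ k, ∀ {n : ℕ} (y : Fin n → (T k).A), π k ∘ y = ρ k ∘ ((T k).f ∘ y) :=
    fun k n y => funext fun i => (hρ k (y i)).symm
  apply Structure.ext
  · funext n f x
    obtain ⟨k, y, rfl⟩ := htup n x
    have a1 := @Elem.funMap Lp _ _ _ S₁ _ (hS₁ k) n (φ.onFunction f) y
    have a2 := @Elem.funMap Lp _ _ _ S₂ _ (hS₂ k) n (φ.onFunction f) ((T k).f ∘ y)
    have a3 := @Elem.funMap Lm _ _ (φ.reduct _) (φ.reduct _) _ (hm k) n f y
    refine a1.symm.trans ?_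
    rw [← hρ, e]
    refine Eq.trans ?_ a2
    exact congrArg (ρ k) a3
  · funext n r x
    obtain ⟨k, y, rfl⟩ := htup n x
    have a1 := @Elem.relMap Lp _ _ _ S₁ _ (hS₁ k) n (φ.onRelation r) y
    have a2 := @Elem.relMap Lp _ _ _ S₂ _ (hS₂ k) n (φ.onRelation r) ((T k).f ∘ y)
    have a3 := @Elem.relMap Lm _ _ (φ.reduct _) (φ.reduct _) _ (hm k) n r y
    refine propext (a1.trans ?_)
    rw [e]
    exact a3.symm.trans a2.symm

/-- Amalgamation: a stage yields two structures with the same reduct on one set. -/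
theorem Stage.amalg {Lm Lp : Language} {φ : Lm →ᴸ Lp} (s : Stage φ) :
    ∃ (D : Type) (S₁ S₂ : Lp.Structure D) (p : s.A → D) (q : s.B → D),
      @LHom.reduct Lm Lp φ D S₁ = @LHom.reduct Lm Lp φ D S₂ ∧
      @Elem Lp s.A D _ S₁ p ∧ @Elem Lp s.B D _ S₂ q ∧ q ∘ s.f = p := by
  choose nxt g hA hB using @Stage.next Lm Lp φ
  exact amalg_aux (fun n => Nat.rec s (fun _ t => nxt t) n) (fun k => g _) (fun k => hA _)
    (fun k => hB _)

theorem Elem.model_iff {L : Language} {M N : Type} [L.Structure M] [L.Structure N] {f : M → N}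
    (h : Elem L f) (T : L.Theory) : T.Model N ↔ T.Model M := by
  have key : ∀ σ : L.Sentence, N ⊨ σ ↔ M ⊨ σ := by
    intro σ
    refine Iff.trans ?_ (h Empty σ default)
    rw [Sentence.Realize, Subsingleton.elim (f ∘ default) (default : Empty → N)]
  rw [Theory.model_iff, Theory.model_iff]
  simp only [key]

theorem ultra_model {L : Language} {I : Type} (U : Ultrafilter I) (X : I → Type)
    [∀ i, L.Structure (X i)] [∀ i, Nonempty (X i)] (T : L.Theory) (h : ∀ i, T.Model (X i)) :
    T.Model ((U : Filter I).Product X) := by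
  rw [Theory.model_iff]
  intro σ hσ
  rw [Ultraproduct.sentence_realize]
  exact Filter.Eventually.of_forall fun i => (Theory.model_iff _).1 (h i) σ hσ

/-- Beth definability over a family of structures. -/
theorem definable {Lm Lp : Language} (φ : Lm →ᴸ Lp) {ι : Type} (C : ι → Type)
    [∀ i, Lp.Structure (C i)] [∀ i, Nonempty (C i)] (Tp : Lp.Theory) (hC : ∀ i, Tp.Model (C i))
    (huniq : ∀ (D : Type) (S₁ S₂ : Lp.Structure D),
      @LHom.reduct Lm Lp φ D S₁ = @LHom.reduct Lm Lp φ D S₂ →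
      @Theory.Model Lp D S₁ Tp → @Theory.Model Lp D S₂ Tp → S₁ = S₂)
    {α : Type} (χ : Lp.Formula α) :
    ∃ ψ : Lm.Formula α, ∀ i (a : α → C i), χ.Realize a ↔ (φ.onFormula ψ).Realize a := by
  by_contra hcon
  push Not at hcon
  let J : Type := Σ i, (α → C i)
  let X : Set J := {j | χ.Realize j.2}
  let Z : Lm.Formula α → Set J := fun ψ => {j | (φ.onFormula ψ).Realize j.2}
  have Zinf : ∀ ψ ψ', Z (ψ ⊓ ψ') = Z ψ ∩ Z ψ' := by
    intro ψ ψ'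
    ext j
    let _ := φ.reduct (C j.1)
    simp [Z, LHom.realize_onFormula, Formula.realize_inf]
  have Znot : ∀ ψ, Z (∼ψ) = (Z ψ)ᶜ := by
    intro ψ
    ext j
    let _ := φ.reduct (C j.1)
    simp [Z, LHom.realize_onFormula, Formula.realize_not]
  have Ztop : Z ⊤ = Set.univ := by
    ext j
    let _ := φ.reduct (C j.1)
    simp [Z, LHom.realize_onFormula]
  have hXZ : ∀ ψ, X ≠ Z ψ := by
    intro ψ h
    obtain ⟨i, a, h'⟩ := hcon ψ
    have : (⟨i, a⟩ : J) ∈ X ↔ (⟨i, a⟩ : J) ∈ Z ψ := by rw [h]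
    have this : χ.Realize a ↔ (φ.onFormula ψ).Realize a := this
    tauto
  obtain ⟨V, hV⟩ := exists_ultra {s | ∃ ψ, X ⊆ Z ψ ∧ s = Z ψ ∩ Xᶜ}
    ⟨_, ⊤, by simp [Ztop], rfl⟩
    (by
      rintro _ ⟨ψ, h, rfl⟩
      by_contra hn
      rw [Set.not_nonempty_iff_eq_empty, ← Set.sdiff_eq, Set.sdiff_eq_empty] at hn
      exact hXZ ψ (h.antisymm hn))
    (by
      rintro _ ⟨ψ, h, rfl⟩ _ ⟨ψ', h', rfl⟩
      refine ⟨ψ ⊓ ψ', ?_, ?_⟩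
      · rw [Zinf]; exact Set.subset_inter h h'
      · rw [Zinf, ← Set.inter_inter_distrib_right])
  have hV1 : ∀ ψ, X ⊆ Z ψ → Z ψ ∈ V := fun ψ h =>
    Filter.mem_of_superset (hV _ ⟨ψ, h, rfl⟩) Set.inter_subset_left
  have hV2 : Xᶜ ∈ V :=
    Filter.mem_of_superset (hV _ ⟨⊤, by simp [Ztop], rfl⟩) Set.inter_subset_right
  obtain ⟨U, hU⟩ := exists_ultra {s | ∃ ψ, Z ψ ∈ V ∧ s = Z ψ ∩ X}
    ⟨_, ⊤, by rw [Ztop]; exact Filter.univ_mem, rfl⟩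
    (by
      rintro _ ⟨ψ, h, rfl⟩
      by_contra hn
      rw [Set.not_nonempty_iff_eq_empty, ← Set.disjoint_iff_inter_eq_empty] at hn
      have h1 : Z (∼ψ) ∈ V := hV1 _ (by rw [Znot]; exact hn.subset_compl_left)
      rw [Znot] at h1
      exact (Ultrafilter.compl_mem_iff_notMem.1 h1) h)
    (by
      rintro _ ⟨ψ, h, rfl⟩ _ ⟨ψ', h', rfl⟩
      refine ⟨ψ ⊓ ψ', ?_, ?_⟩
      · rw [Zinf]; exact Filter.inter_mem h h'
      · rw [Zinf, ← Set.inter_inter_distrib_right])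
  have hU1 : ∀ ψ, Z ψ ∈ V → Z ψ ∈ U := fun ψ h =>
    Filter.mem_of_superset (hU _ ⟨ψ, h, rfl⟩) Set.inter_subset_left
  have hU2 : X ∈ U :=
    Filter.mem_of_superset (hU _ ⟨⊤, by rw [Ztop]; exact Filter.univ_mem, rfl⟩)
      Set.inter_subset_right
  have hUV : ∀ ψ, Z ψ ∈ U → Z ψ ∈ V := by
    intro ψ h
    by_contra hn
    have h1 : Z (∼ψ) ∈ V := by rw [Znot]; exact Ultrafilter.compl_mem_iff_notMem.2 hn
    have h2 := hU1 _ h1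
    rw [Znot] at h2
    exact (Ultrafilter.compl_mem_iff_notMem.1 h2) h
  let Y : J → Type := fun j => C j.1
  let _ : ∀ j, Lp.Structure (Y j) := fun j => inferInstanceAs (Lp.Structure (C j.1))
  have _ : ∀ j, Nonempty (Y j) := fun j => inferInstanceAs (Nonempty (C j.1))
  have hY : ∀ j, Tp.Model (Y j) := fun j => hC j.1
  let a : α → (U : Filter J).Product Y := fun x => cls U Y (fun j => j.2 x)
  let b : α → (V : Filter J).Product Y := fun x => cls V Y (fun j => j.2 x)
  have ha : ∀ χ' : Lp.Formula α, χ'.Realize a ↔ {j : J | χ'.Realize j.2} ∈ U :=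
    fun χ' => los U Y χ' (fun x j => j.2 x)
  have hb : ∀ χ' : Lp.Formula α, χ'.Realize b ↔ {j : J | χ'.Realize j.2} ∈ V :=
    fun χ' => los V Y χ' (fun x j => j.2 x)
  have _ : Nonempty ((U : Filter J).Product Y) := Ultraproduct.Product.instNonempty
  have _ : Nonempty ((V : Filter J).Product Y) := Ultraproduct.Product.instNonempty
  obtain ⟨B, sB, nB, f, d, hf, hd, hfd⟩ := step φ a b
    (fun ψ h => (hb _).2 (hUV ψ ((ha _).1 h)))
  obtain ⟨D, S₁, S₂, p, q, h1, h2, h3, h4⟩ :=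
    Stage.amalg (φ := φ) ⟨(U : Filter J).Product Y, B, f, hf⟩
  have hm1 : @Theory.Model Lp D S₁ Tp :=
    (@Elem.model_iff Lp _ _ _ S₁ _ h2 Tp).2 (ultra_model U Y Tp hY)
  have hm2 : @Theory.Model Lp D S₂ Tp :=
    (@Elem.model_iff Lp _ _ _ S₂ _ h3 Tp).2 ((hd.model_iff Tp).2 (ultra_model V Y Tp hY))
  obtain rfl := huniq D S₁ S₂ h1 hm1 hm2
  have r1 : χ.Realize (p ∘ a) := (h2 α χ a).2 ((ha χ).2 hU2)
  have r2 : ¬ χ.Realize b := fun h => Ultrafilter.compl_mem_iff_notMem.1 hV2 ((hb χ).1 h)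
  apply r2
  rw [← hd α χ b, ← hfd]
  refine (h3 α χ (f ∘ a)).1 ?_
  rw [← Function.comp_assoc]
  have h4 : q ∘ f = p := h4
  rw [h4]
  exact r1

/-- Pulling an expansion back along an elementary map of reducts. -/
theorem pull_back {Lm Lp : Language} (φ : Lm →ᴸ Lp) {M N : Type} [SM : Lm.Structure M]
    [Lp.Structure N] (g : M → N)
    (hg : ∀ (α : Type) (θ : Lm.Formula α) (v : α → M),
      (φ.onFormula θ).Realize (g ∘ v) ↔ θ.Realize v)
    (hdef : ∀ (α : Type) (χ : Lp.Formula α), ∃ ψ : Lm.Formula α, ∀ a : α → N,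
      χ.Realize a ↔ (φ.onFormula ψ).Realize a)
    (Tp : Lp.Theory) (hN : Tp.Model N) :
    ∃ S : Lp.Structure M, @LHom.reduct Lm Lp φ M S = SM ∧ @Theory.Model Lp M S Tp := by
  have hg' : @Elem Lm M N _ (φ.reduct N) g := by
    intro α ψ v
    let _ := φ.reduct N
    rw [← hg, LHom.realize_onFormula]
  have wit : ∀ (α : Type) (χ : Lp.Formula (α ⊕ Unit)) (x : α → M) (n : N),
      χ.Realize (Sum.elim (g ∘ x) (fun _ => n)) →
        ∃ m : M, χ.Realize (Sum.elim (g ∘ x) (fun _ => g m)) := by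
    intro α χ x n h
    obtain ⟨ψ, hψ⟩ := hdef _ χ
    rw [hψ] at h
    have h1 : (ψ.iExs Unit).Realize x := by
      rw [← hg]
      let _ := φ.reduct N
      rw [LHom.realize_onFormula] at h ⊢
      rw [Formula.realize_iExs]
      exact ⟨_, h⟩
    rw [Formula.realize_iExs] at h1
    obtain ⟨m, hm⟩ := h1
    refine ⟨m (), ?_⟩
    rw [hψ]
    rw [← hg, Sum.comp_elim] at hm
    exact hm
  have hcl : ∀ (n : ℕ) (f : Lp.Functions n) (x : Fin n → M), ∃ m, g m = funMap f (g ∘ x) := by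
    intro n f x
    obtain ⟨m, hm⟩ := wit (Fin n) (Term.equal (Term.var (Sum.inr ()))
      (Term.func f (fun i => Term.var (Sum.inl i)))) x (funMap f (g ∘ x))
      (by simp [Formula.realize_equal, Function.comp_def])
    refine ⟨m, ?_⟩
    simpa [Formula.realize_equal, Function.comp_def] using hm
  choose F hF using hcl
  let S : Lp.Structure M :=
    { funMap := fun {n} f x => F n f x
      RelMap := fun {n} r x => RelMap r (g ∘ x) }
  let G : M ↪[Lp] N :=
    { toFun := g
      inj' := @Elem.inj Lm M N _ (φ.reduct N) g hg'
      map_fun' := fun f x => hF _ f x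
      map_rel' := fun r x => Iff.rfl }
  have hel : ∀ (n : ℕ) (ψ : Lp.Formula (Fin n)) (x : Fin n → M),
      ψ.Realize (G ∘ x) ↔ ψ.Realize x := fun n => G.isElementary_of_exists (by
    intro n χ x a h
    have e : ∀ c : N, (Fin.snoc (G ∘ x) c : Fin (n + 1) → N) =
        Sum.elim (g ∘ x) (fun _ => c) ∘ (Fin.snoc (α := fun _ => Fin n ⊕ Unit) Sum.inl (Sum.inr ())) := by
      intro c
      rw [Fin.comp_snoc]
      rfl
    have e' : ∀ c : N, (χ.toFormula.relabel (Sum.elim Empty.elim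
        (Fin.snoc (α := fun _ => Fin n ⊕ Unit) Sum.inl (Sum.inr ())))).Realize
          (Sum.elim (g ∘ x) (fun _ => c)) ↔
        χ.Realize default (Fin.snoc (G ∘ x) c : Fin (n + 1) → N) := by
      intro c
      rw [Formula.realize_relabel, BoundedFormula.realize_toFormula, e]
      have : ∀ u : Empty → N, u = default := fun u => Subsingleton.elim _ _
      rw [this (_ ∘ Sum.inl)]
      rfl
    obtain ⟨m, hm⟩ := wit _ _ x a ((e' a).2 h)
    exact ⟨m, (e' (g m)).1 hm⟩)
  refine ⟨S, ?_, ?_⟩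
  · apply Structure.ext
    · funext n f x
      apply @Elem.inj Lm M N _ (φ.reduct N) g hg'
      refine (hF n (φ.onFunction f) x).trans ?_
      exact (@Elem.funMap Lm M N _ (φ.reduct N) g hg' n f x).symm
    · funext n r x
      exact propext (@Elem.relMap Lm M N _ (φ.reduct N) g hg' n r x)
  · let G' : M ↪ₑ[Lp] N := ⟨G, fun n ψ x => hel n ψ x⟩
    exact (G'.theory_model_iff Tp).2 hN

end BethAux

/-- Beth-style existence and uniqueness of expansions.  Let `φ : L⁻ → L⁺` be an
expansion of first-order languages, `C = (C i)_{i : ι}` a class of nonempty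
`L⁻`-structures, `T⁻` the common `L⁻`-theory of `C`, and `T⁺` an `L⁺`-theory
containing (the translation of) `T⁻`.  If every model of `T⁻` has at most one
expansion to a model of `T⁺`, and every member of `C` has at least one such
expansion, then every model of `T⁻` has exactly one expansion to a model of
`T⁺`. -/
theorem stmt9 (Lm Lp : Language) (φ : Lm →ᴸ Lp)
    (ι : Type) (C : ι → Type) [SC : ∀ i, Lm.Structure (C i)] [∀ i, Nonempty (C i)]
    (Tm : Lm.Theory) (hTm : Tm = {σ : Lm.Sentence | ∀ i, C i ⊨ σ})
    (Tp : Lp.Theory) (hsub : φ.onTheory Tm ⊆ Tp)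
    (huniq : ∀ (M : Type) (SM : Lm.Structure M) (S₁ S₂ : Lp.Structure M),
      @LHom.reduct Lm Lp φ M S₁ = SM → @LHom.reduct Lm Lp φ M S₂ = SM →
      @Theory.Model Lm M SM Tm →
      @Theory.Model Lp M S₁ Tp → @Theory.Model Lp M S₂ Tp → S₁ = S₂)
    (hexist : ∀ i : ι, ∃ S : Lp.Structure (C i),
      @LHom.reduct Lm Lp φ (C i) S = SC i ∧ @Theory.Model Lp (C i) S Tp) :
    ∀ (M : Type) (SM : Lm.Structure M), @Theory.Model Lm M SM Tm →
      ∃! S : Lp.Structure M,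
        @LHom.reduct Lm Lp φ M S = SM ∧ @Theory.Model Lp M S Tp := by
  intro M SM hM
  choose SP hred hmod using hexist
  have hexp : ∀ i, φ.IsExpansionOn (C i) := by
    intro i
    rw [← hred i]
    exact LHom.isExpansionOn_reduct φ (C i)
  have hred' : ∀ (D : Type) (S : Lp.Structure D), @Theory.Model Lp D S Tp →
      @Theory.Model Lm D (@LHom.reduct Lm Lp φ D S) Tm := by
    intro D S h
    let _ := φ.reduct D
    exact (LHom.onTheory_model φ Tm).1 (h.mono hsub)
  have huniq' : ∀ (D : Type) (S₁ S₂ : Lp.Structure D),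
      @LHom.reduct Lm Lp φ D S₁ = @LHom.reduct Lm Lp φ D S₂ →
      @Theory.Model Lp D S₁ Tp → @Theory.Model Lp D S₂ Tp → S₁ = S₂ := by
    intro D S₁ S₂ h h1 h2
    refine huniq D _ S₁ S₂ rfl h.symm ?_ h1 h2
    exact hred' D S₁ h1
  have hdef := fun (α : Type) (χ : Lp.Formula α) => BethAux.definable φ C Tp hmod huniq' χ
  obtain ⟨U, hU⟩ := BethAux.frayne φ (I := Σ i, (M → C i)) (fun j => C j.1) (fun j => j.2) (by
    intro θ hθ
    by_contra hn
    push Not at hn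
    obtain ⟨χ, h1, h2⟩ := BethAux.exists_closure (Empty.elim : Empty → M) θ hθ
    have h3 : (∼χ : Lm.Sentence) ∈ Tm := by
      rw [hTm]
      intro i
      have h4 : ¬ Formula.Realize χ (default : Empty → C i) := by
        intro h4
        obtain ⟨v, _, hv⟩ := h2 (C i) default (fun x => x.elim) h4
        refine hn ⟨i, v⟩ ?_
        exact (LHom.realize_onFormula φ θ).2 hv
      exact h4
    have h5 : ¬ Formula.Realize χ (default : Empty → M) := (Theory.model_iff _).1 hM _ h3
    apply h5
    rwa [Subsingleton.elim (default : Empty → M) Empty.elim])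
  obtain ⟨S, hS1, hS2⟩ := BethAux.pull_back φ
    (fun m => BethAux.cls U (fun j : Σ i, (M → C i) => C j.1) (fun j => j.2 m)) hU
    (by
      intro α χ
      obtain ⟨ψ, hψ⟩ := hdef α χ
      refine ⟨ψ, fun a => ?_⟩
      obtain ⟨a', rfl⟩ : ∃ a' : α → ∀ j : Σ i, (M → C i), C j.1,
          (fun x => BethAux.cls U (fun j : Σ i, (M → C i) => C j.1) (a' x)) = a :=
        ⟨fun x => (a x).out, funext fun x => Quotient.out_eq (a x)⟩
      rw [BethAux.los, BethAux.los]
      simp only [hψ])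
    Tp (BethAux.ultra_model U _ Tp (fun j => hmod j.1))
  exact ⟨S, ⟨hS1, hS2⟩, fun S' h => huniq M SM S' S h.1 hS1 hM h.2 hS2⟩
end
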